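/- Equivalence of the Clifford–Beltrami equation (2.7) and the div-curl system (2.8): Let σ : U → ℝ satisfy σ(x) > 0 on an open set U ⊆ ℝ³, and set μ = (1 − σ)/(1 + σ). Let u, u₀, u₁, u₂ be real-valued functions differentiable on U and F = u·e₀ + u₂·e₁ − u₁·e₂ − u₀·e₃. Then at a point x ∈ U, the equation D F = μ(x)·(D F̄) holds if and only if curl(u₀,u₁,u₂)(x) = σ(x)·∇u(x) and div(u₀,u₁,u₂)(x) = 0. -/

import Mathlib

open scoped Quaternion

noncomputable section

/-- Partial derivative of a quaternion-valued function in the `j`-th coordinate direction. -/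
def pd (j : Fin 3) (f : (Fin 3 → ℝ) → ℍ[ℝ]) (x : Fin 3 → ℝ) : ℍ[ℝ] :=
  fderiv ℝ f x (Pi.single j 1)

/-- Partial derivative of a real-valued function in the `j`-th coordinate direction. -/
def pdR (j : Fin 3) (u : (Fin 3 → ℝ) → ℝ) (x : Fin 3 → ℝ) : ℝ :=
  fderiv ℝ u x (Pi.single j 1)

/-- The basis element `e₁ = i`. -/
def e1 : ℍ[ℝ] := ⟨0, 1, 0, 0⟩

/-- The basis element `e₂ = j`. -/
def e2 : ℍ[ℝ] := ⟨0, 0, 1, 0⟩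

/-- The Cauchy–Riemann operator `D f = ∂₀ f + e₁ ∂₁ f + e₂ ∂₂ f`. -/
def CR (f : (Fin 3 → ℝ) → ℍ[ℝ]) (x : Fin 3 → ℝ) : ℍ[ℝ] :=
  pd 0 f x + e1 * pd 1 f x + e2 * pd 2 f x

/-- `F = u e₀ + u₂ e₁ − u₁ e₂ − u₀ e₃`. -/
def Fq (u u₀ u₁ u₂ : (Fin 3 → ℝ) → ℝ) : (Fin 3 → ℝ) → ℍ[ℝ] :=
  fun y => ⟨u y, u₂ y, -u₁ y, -u₀ y⟩


@[simp] theorem re_e1 : e1.re = 0 := rfl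
@[simp] theorem imI_e1 : e1.imI = 1 := rfl
@[simp] theorem imJ_e1 : e1.imJ = 0 := rfl
@[simp] theorem imK_e1 : e1.imK = 0 := rfl
@[simp] theorem re_e2 : e2.re = 0 := rfl
@[simp] theorem imI_e2 : e2.imI = 0 := rfl
@[simp] theorem imJ_e2 : e2.imJ = 1 := rfl
@[simp] theorem imK_e2 : e2.imK = 0 := rfl

/-- Partial derivatives of a quaternion-valued function are computed componentwise. -/
theorem pd_components {f : (Fin 3 → ℝ) → ℍ[ℝ]} {a b c d : (Fin 3 → ℝ) → ℝ} {x : Fin 3 → ℝ}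
    (hre : ∀ y, (f y).re = a y) (hI : ∀ y, (f y).imI = b y)
    (hJ : ∀ y, (f y).imJ = c y) (hK : ∀ y, (f y).imK = d y)
    (ha : DifferentiableAt ℝ a x) (hb : DifferentiableAt ℝ b x)
    (hc : DifferentiableAt ℝ c x) (hd : DifferentiableAt ℝ d x) (j : Fin 3) :
    (pd j f x).re = pdR j a x ∧ (pd j f x).imI = pdR j b x ∧
      (pd j f x).imJ = pdR j c x ∧ (pd j f x).imK = pdR j d x := by
  have hf : f = fun y => a y • (1 : ℍ[ℝ]) + b y • e1 + c y • e2 + d y • (e1 * e2) := by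
    funext y
    apply Quaternion.ext <;> simp [hre, hI, hJ, hK]
  have h : HasFDerivAt f _ x := hf ▸ (((ha.hasFDerivAt.smul_const (1 : ℍ[ℝ])).fun_add
    (hb.hasFDerivAt.smul_const e1)).fun_add (hc.hasFDerivAt.smul_const e2)).fun_add
    (hd.hasFDerivAt.smul_const (e1 * e2))
  simp [pd, pdR, h.fderiv]

theorem pdR_neg (j : Fin 3) (f : (Fin 3 → ℝ) → ℝ) (x : Fin 3 → ℝ) :
    pdR j (fun y => -f y) x = -pdR j f x := by
  simp [pdR, fderiv_fun_neg]

/-- Equivalence of the Clifford–Beltrami equation (2.7) and the div-curl system (2.8):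
with `μ = (1 − σ)/(1 + σ)`, the equation `D F = μ (D F̄)` holds at `x ∈ U` iff
`curl(u₀,u₁,u₂)(x) = σ(x) ∇u(x)` and `div(u₀,u₁,u₂)(x) = 0`. -/
theorem beltrami_iff_divcurl (U : Set (Fin 3 → ℝ)) (hU : IsOpen U)
    (σ : (Fin 3 → ℝ) → ℝ) (hσ : ∀ x ∈ U, 0 < σ x)
    (u u₀ u₁ u₂ : (Fin 3 → ℝ) → ℝ)
    (hu : DifferentiableOn ℝ u U) (hu0 : DifferentiableOn ℝ u₀ U)
    (hu1 : DifferentiableOn ℝ u₁ U) (hu2 : DifferentiableOn ℝ u₂ U)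
    (x : Fin 3 → ℝ) (hx : x ∈ U) :
    CR (Fq u u₀ u₁ u₂) x =
        ((1 - σ x) / (1 + σ x)) • CR (fun y => star (Fq u u₀ u₁ u₂ y)) x ↔
      (pdR 1 u₂ x - pdR 2 u₁ x = σ x * pdR 0 u x ∧
       pdR 2 u₀ x - pdR 0 u₂ x = σ x * pdR 1 u x ∧
       pdR 0 u₁ x - pdR 1 u₀ x = σ x * pdR 2 u x) ∧
      pdR 0 u₀ x + pdR 1 u₁ x + pdR 2 u₂ x = 0 := by
  have hU' := hU.mem_nhds hx
  have du := hu.differentiableAt hU'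
  have d0 := hu0.differentiableAt hU'
  have d1 := hu1.differentiableAt hU'
  have d2 := hu2.differentiableAt hU'
  have hs : 1 + σ x ≠ 0 := by linarith [hσ x hx]
  have hF := pd_components (f := Fq u u₀ u₁ u₂)
    (a := u) (b := u₂) (c := fun y => -u₁ y) (d := fun y => -u₀ y)
    (fun _ => rfl) (fun _ => rfl) (fun _ => rfl) (fun _ => rfl) du d2 d1.fun_neg d0.fun_neg
  have hG := pd_components (f := fun y => star (Fq u u₀ u₁ u₂ y))
    (a := u) (b := fun y => -u₂ y) (c := u₁) (d := u₀)
    (fun y => by rw [Quaternion.re_star]; rfl) (fun y => by rw [Quaternion.imI_star]; rfl)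
    (fun y => by rw [Quaternion.imJ_star]; exact neg_neg _)
    (fun y => by rw [Quaternion.imK_star]; exact neg_neg _) du d2.fun_neg d1 d0
  simp only [pdR_neg, forall_and] at hF hG
  obtain ⟨hF0, hF1, hF2, hF3⟩ := hF
  obtain ⟨hG0, hG1, hG2, hG3⟩ := hG
  -- Each component of the equation reads `p - q = μ (p + q)`, that is, `q = σ p`.
  have key (p q : ℝ) : p - q = (1 - σ x) / (1 + σ x) * (p + q) ↔ q = σ x * p := by
    rw [div_mul_eq_mul_div, eq_div_iff hs]
    constructor <;> intro h <;> linarith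
  have k0 := key (pdR 0 u x) (pdR 1 u₂ x - pdR 2 u₁ x)
  have k1 := key (pdR 1 u x) (pdR 2 u₀ x - pdR 0 u₂ x)
  have k2 := key (pdR 2 u x) (pdR 0 u₁ x - pdR 1 u₀ x)
  have k3 := key 0 (pdR 0 u₀ x + pdR 1 u₁ x + pdR 2 u₂ x)
  rw [mul_zero] at k3
  rw [← k0, ← k1, ← k2, ← k3]
  simp only [CR, Quaternion.ext_iff, Quaternion.re_add, Quaternion.imI_add,
    Quaternion.imJ_add, Quaternion.imK_add, Quaternion.re_mul, Quaternion.imI_mul,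
    Quaternion.imJ_mul, Quaternion.imK_mul, Quaternion.re_smul, Quaternion.imI_smul,
    Quaternion.imJ_smul, Quaternion.imK_smul, smul_eq_mul, and_assoc, re_e1, imI_e1, imJ_e1,
    imK_e1, re_e2, imI_e2, imJ_e2, imK_e2, hF0, hF1, hF2, hF3, hG0, hG1, hG2, hG3]
  ring_nf
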